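/- arXiv:1311.2298 — 2 statements merged into one kernel-verified Lean document; each statement's English description precedes it below -/
import Mathlib

section
/- Let ℬ ⊆ 𝒫(n) be a simply rooted family of size m, and let m' be the number of sets B ∈ ℬ with δB ⊆ ℬ. Then ‖ℬ‖ ≤ ‖I(m)‖ + m − m'. -/
open Finset
open scoped Classical

/-- The total size `‖𝒜‖ = Σ_{A∈𝒜} |A|` of a family of finite sets. -/
def totalSize (𝒜 : Finset (Finset ℕ)) : ℕ := ∑ A ∈ 𝒜, A.card

/-- A family is union-closed if it is closed under pairwise unions. -/
def UnionClosed (𝒜 : Finset (Finset ℕ)) : Prop := ∀ A ∈ 𝒜, ∀ B ∈ 𝒜, A ∪ B ∈ 𝒜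

/-- The `k`-th finite set of positive integers in the colex order: the positive
integer `i` belongs to it iff bit `i - 1` of `k` is set. -/
def colexSet (k : ℕ) : Finset ℕ :=
  ((Finset.range (k + 1)).filter fun i => k.testBit i).image (· + 1)

/-- The initial segment `I(m)` of length `m` of the colex order on finite sets
of positive integers. -/
def colexInit (m : ℕ) : Finset (Finset ℕ) := (Finset.range m).image colexSet

/-- A family `ℬ` is simply rooted if every nonempty `B ∈ ℬ` has some `b ∈ B`
with the whole cube `[{b}, B]` contained in `ℬ`. -/
def SimplyRooted (ℬ : Finset (Finset ℕ)) : Prop :=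
  ∀ B ∈ ℬ, B.Nonempty → ∃ b ∈ B, ∀ C : Finset ℕ, {b} ⊆ C → C ⊆ B → C ∈ ℬ

/-- `B` is `ℬ`-rooted at `i`: `i ∈ B` and the cube `[{i}, B]` lies in `ℬ`. -/
def RootedAt (ℬ : Finset (Finset ℕ)) (B : Finset ℕ) (i : ℕ) : Prop :=
  i ∈ B ∧ ∀ C : Finset ℕ, {i} ⊆ C → C ⊆ B → C ∈ ℬ

/-- `ℬ_S`: the sets of `ℬ` that are `ℬ`-rooted at some element of `S`. -/
noncomputable def rootedFam (ℬ : Finset (Finset ℕ)) (S : Finset ℕ) : Finset (Finset ℕ) :=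
  ℬ.filter fun B => ∃ i ∈ S, RootedAt ℬ B i

/-- The image of a single set `B` under the down-compression of `ℬ` in
direction `i`. -/
def compressSet (ℬ : Finset (Finset ℕ)) (i : ℕ) (B : Finset ℕ) : Finset ℕ :=
  if i ∈ B ∧ B.erase i ∉ ℬ then B.erase i else B

/-- The down-compression `d_i(ℬ)` of the family `ℬ` in direction `i`. -/
def dComp (i : ℕ) (ℬ : Finset (Finset ℕ)) : Finset (Finset ℕ) :=
  ℬ.image (compressSet ℬ i)

/-- `D_k(ℬ) = d_k(⋯ d_1(ℬ) ⋯)`.  In particular `d(ℬ) = D_n(ℬ)` for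
`ℬ ⊆ 𝒫(n)`. -/
def DComp : ℕ → Finset (Finset ℕ) → Finset (Finset ℕ)
  | 0, ℬ => ℬ
  | k + 1, ℬ => dComp (k + 1) (DComp k ℬ)

/-- `D_{(ℬ,k)}(B)`: the image of the set `B` obtained by following `B` through
the successive compressions `d_1, …, d_k`.  In particular `d_ℬ(B) = D_{(ℬ,n)}(B)`
for `ℬ ⊆ 𝒫(n)`. -/
def DCompSet : ℕ → Finset (Finset ℕ) → Finset ℕ → Finset ℕ
  | 0, _, B => B
  | k + 1, ℬ, B => compressSet (DComp k ℬ) (k + 1) (DCompSet k ℬ B)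

/-- The shadow `δB = {B \ {i} : i ∈ B}` of a finite set `B`. -/
def shadowSet (B : Finset ℕ) : Finset (Finset ℕ) := B.image fun i => B.erase i

/-- `B` is a bad set of `ℬ ⊆ 𝒫(n)` if `δB ⊆ ℬ` or `d_ℬ(B) = B`. -/
def BadSet (n : ℕ) (ℬ : Finset (Finset ℕ)) (B : Finset ℕ) : Prop :=
  shadowSet B ⊆ ℬ ∨ DCompSet n ℬ B = B

/-- A family is a down-set if it is closed under taking subsets. -/
def IsDownSet (𝒟 : Finset (Finset ℕ)) : Prop := ∀ A ∈ 𝒟, ∀ B ⊆ A, B ∈ 𝒟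

/-- The deficiency `def(ℬ) = Σ_{B∈ℬ} |δB \ ℬ|`. -/
def deficiency (ℬ : Finset (Finset ℕ)) : ℕ := ∑ B ∈ ℬ, (shadowSet B \ ℬ).card

/-- `𝒜 ⊆ 𝒫(n)` is a counterexample to the union-closed conjecture:
union-closed, not `{∅}`, and every element of `[n]` has degree `< |𝒜|/2`. -/
def UCCounterexample (n : ℕ) (𝒜 : Finset (Finset ℕ)) : Prop :=
  𝒜 ⊆ (Finset.Icc 1 n).powerset ∧ UnionClosed 𝒜 ∧ 𝒜 ≠ {∅} ∧
    ∀ i ∈ Finset.Icc 1 n, ((𝒜.filter fun A => i ∈ A).card : ℚ) < (𝒜.card : ℚ) / 2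

theorem succ_mem_colexSet {k i : ℕ} : i + 1 ∈ colexSet k ↔ k.testBit i := by
  simp only [colexSet, mem_image, mem_filter, mem_range, Nat.add_right_cancel_iff,
    exists_eq_right, and_iff_right_iff_imp]
  intro h
  have h₁ := Nat.ge_two_pow_of_testBit h
  have h₂ := Nat.lt_two_pow_self (n := i)
  omega

theorem zero_notMem_colexSet (k : ℕ) : 0 ∉ colexSet k := by
  simp [colexSet]

theorem colexSet_injective : Function.Injective colexSet := by
  intro k l h
  refine Nat.eq_of_testBit_eq fun i => ?_
  rw [Bool.eq_iff_iff, ← succ_mem_colexSet, ← succ_mem_colexSet, h]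

theorem card_colexSet_two_mul (k : ℕ) : (colexSet (2 * k)).card = (colexSet k).card := by
  have h : colexSet (2 * k) = (colexSet k).image (· + 1) := by
    ext i
    rcases i with _ | _ | i
    · simp [zero_notMem_colexSet]
    · rw [succ_mem_colexSet]
      simp [zero_notMem_colexSet]
    · rw [succ_mem_colexSet, Nat.testBit_succ]
      simp [succ_mem_colexSet]
  rw [h, card_image_of_injective _ (add_left_injective 1)]

theorem card_colexSet_two_mul_add_one (k : ℕ) :
    (colexSet (2 * k + 1)).card = (colexSet k).card + 1 := by
  have h : colexSet (2 * k + 1) = insert 1 ((colexSet k).image (· + 1)) := by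
    ext i
    rcases i with _ | _ | i
    · simp [zero_notMem_colexSet]
    · rw [succ_mem_colexSet]
      simp
    · rw [succ_mem_colexSet, Nat.testBit_succ, show (2 * k + 1) / 2 = k by omega]
      simp [succ_mem_colexSet]
  rw [h, card_insert_of_notMem, card_image_of_injective _ (add_left_injective 1)]
  simp [zero_notMem_colexSet]

theorem totalSize_colexInit (m : ℕ) :
    totalSize (colexInit m) = ∑ k ∈ range m, (colexSet k).card :=
  sum_image colexSet_injective.injOn

theorem totalSize_colexInit_zero : totalSize (colexInit 0) = 0 := by
  simp [totalSize_colexInit]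

theorem totalSize_colexInit_succ (m : ℕ) :
    totalSize (colexInit (m + 1)) = totalSize (colexInit m) + (colexSet m).card := by
  rw [totalSize_colexInit, totalSize_colexInit, sum_range_succ]

theorem totalSize_colexInit_two_mul (m : ℕ) :
    totalSize (colexInit (2 * m)) = 2 * totalSize (colexInit m) + m := by
  induction m with
  | zero => simp [totalSize_colexInit_zero]
  | succ m ih =>
    rw [show 2 * (m + 1) = 2 * m + 1 + 1 by ring, totalSize_colexInit_succ,
      totalSize_colexInit_succ, ih, card_colexSet_two_mul, card_colexSet_two_mul_add_one,
      totalSize_colexInit_succ]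
    ring

theorem totalSize_colexInit_two_mul_add_one (m : ℕ) :
    totalSize (colexInit (2 * m + 1)) =
      totalSize (colexInit m) + totalSize (colexInit (m + 1)) + m := by
  rw [totalSize_colexInit_succ, totalSize_colexInit_two_mul, card_colexSet_two_mul,
    totalSize_colexInit_succ]
  ring

theorem totalSize_colexInit_add_le (a b : ℕ) :
    totalSize (colexInit a) + totalSize (colexInit b) + min a b ≤
      totalSize (colexInit (a + b)) := by
  induction hs : a + b using Nat.strong_induction_on generalizing a b with
  | _ s ih =>
  subst hs
  rcases Nat.eq_zero_or_pos a with rfl | ha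
  · simp [totalSize_colexInit_zero]
  rcases Nat.eq_zero_or_pos b with rfl | hb
  · simp [totalSize_colexInit_zero]
  obtain ⟨c, rfl | rfl⟩ := Nat.even_or_odd' a <;> obtain ⟨d, rfl | rfl⟩ := Nat.even_or_odd' b
  · have h := ih (c + d) (by omega) c d rfl
    rw [← mul_add, totalSize_colexInit_two_mul, totalSize_colexInit_two_mul,
      totalSize_colexInit_two_mul]
    omega
  · have h₁ := ih (c + d) (by omega) c d rfl
    have h₂ := ih (c + d + 1) (by omega) c (d + 1) (by ring)
    rw [show 2 * c + (2 * d + 1) = 2 * (c + d) + 1 by ring, totalSize_colexInit_two_mul,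
      totalSize_colexInit_two_mul_add_one, totalSize_colexInit_two_mul_add_one]
    omega
  · have h₁ := ih (c + d) (by omega) c d rfl
    have h₂ := ih (c + d + 1) (by omega) (c + 1) d (by ring)
    rw [show 2 * c + 1 + 2 * d = 2 * (c + d) + 1 by ring, totalSize_colexInit_two_mul,
      totalSize_colexInit_two_mul_add_one, totalSize_colexInit_two_mul_add_one]
    omega
  · have h₁ := ih (c + d + 1) (by omega) c (d + 1) (by ring)
    have h₂ := ih (c + d + 1) (by omega) (c + 1) d (by ring)
    rw [show 2 * c + 1 + (2 * d + 1) = 2 * (c + d + 1) by ring, totalSize_colexInit_two_mul,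
      totalSize_colexInit_two_mul_add_one, totalSize_colexInit_two_mul_add_one]
    omega

/-- The number of edges of the discrete cube with both ends in `ℬ`. -/
noncomputable def edgeCount (ℬ : Finset (Finset ℕ)) : ℕ :=
  ∑ B ∈ ℬ, (B.filter fun i => B.erase i ∈ ℬ).card

theorem edgeCount_le_subfamilies (a : ℕ) (ℬ : Finset (Finset ℕ)) :
    edgeCount ℬ ≤ edgeCount (ℬ.nonMemberSubfamily a) + edgeCount (ℬ.memberSubfamily a) +
      min (ℬ.nonMemberSubfamily a).card (ℬ.memberSubfamily a).card := by
  have h₀ : ∑ B ∈ ℬ with a ∉ B, (B.filter fun i => B.erase i ∈ ℬ).card =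
      edgeCount (ℬ.nonMemberSubfamily a) := by
    refine sum_congr rfl fun B hB => ?_
    have ha : a ∉ B := (mem_filter.1 hB).2
    congr 1
    ext i
    simp [mem_nonMemberSubfamily, ha]
  have h₁ : ∑ B ∈ ℬ with a ∈ B, (B.filter fun i => B.erase i ∈ ℬ).card ≤
      edgeCount (ℬ.memberSubfamily a) +
        (ℬ.memberSubfamily a ∩ ℬ.nonMemberSubfamily a).card := by
    have hfam : ℬ.memberSubfamily a = (ℬ.filter (a ∈ ·)).image fun B => B.erase a := rfl
    have hinj : Set.InjOn (fun B : Finset ℕ => B.erase a) (ℬ.filter (a ∈ ·)) :=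
      fun B hB C hC h => (erase_injOn' a) (mem_filter.1 hB).2 (mem_filter.1 hC).2 h
    rw [edgeCount, ← filter_mem_eq_inter, card_filter, ← sum_add_distrib]
    conv_rhs => rw [hfam, sum_image hinj]
    rw [← hfam]
    refine sum_le_sum fun B hB => ?_
    obtain ⟨-, ha⟩ := mem_filter.1 hB
    have hsub : (B.filter fun i => B.erase i ∈ ℬ) ⊆
        ((B.erase a).filter fun i => (B.erase a).erase i ∈ ℬ.memberSubfamily a) ∪
          (if B.erase a ∈ ℬ.nonMemberSubfamily a then {a} else ∅) := by
      intro i hi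
      obtain ⟨hiB, hi⟩ := mem_filter.1 hi
      rcases eq_or_ne i a with rfl | hia
      · simp [mem_nonMemberSubfamily, hi]
      · refine mem_union_left _ (mem_filter.2 ⟨mem_erase.2 ⟨hia, hiB⟩, ?_⟩)
        rw [mem_memberSubfamily, erase_right_comm, insert_erase (mem_erase.2 ⟨hia.symm, ha⟩)]
        exact ⟨hi, notMem_erase _ _⟩
    refine (card_le_card hsub).trans ((card_union_le _ _).trans ?_)
    gcongr
    split_ifs <;> simp
  have h₂ : (ℬ.memberSubfamily a ∩ ℬ.nonMemberSubfamily a).card ≤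
      min (ℬ.nonMemberSubfamily a).card (ℬ.memberSubfamily a).card :=
    le_min (card_le_card inter_subset_right) (card_le_card inter_subset_left)
  have h₃ := sum_filter_add_sum_filter_not ℬ (a ∈ ·)
    fun B => (B.filter fun i => B.erase i ∈ ℬ).card
  rw [edgeCount, ← h₃]
  omega

/-- The edge-isoperimetric inequality in the discrete cube. -/
theorem edgeCount_le_totalSize_colexInit (S : Finset ℕ) :
    ∀ ℬ ⊆ S.powerset, edgeCount ℬ ≤ totalSize (colexInit ℬ.card) := by
  induction S using Finset.induction_on with
  | empty =>
    intro ℬ hℬ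
    have h : edgeCount ℬ = 0 := sum_eq_zero fun B hB => by
      have := hℬ hB
      simp_all
    omega
  | insert a S ha ih =>
    intro ℬ hℬ
    have h₀ := ih (ℬ.nonMemberSubfamily a) fun B hB => by
      obtain ⟨hB, haB⟩ := mem_nonMemberSubfamily.1 hB
      exact mem_powerset.2 ((subset_insert_iff_of_notMem haB).1 (mem_powerset.1 (hℬ hB)))
    have h₁ := ih (ℬ.memberSubfamily a) fun B hB => by
      obtain ⟨hB, haB⟩ := mem_memberSubfamily.1 hB
      exact mem_powerset.2 ((insert_subset_insert_iff haB).1 (mem_powerset.1 (hℬ hB)))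
    have h₂ := totalSize_colexInit_add_le (ℬ.nonMemberSubfamily a).card
      (ℬ.memberSubfamily a).card
    have h₃ := edgeCount_le_subfamilies a ℬ
    rw [← card_memberSubfamily_add_card_nonMemberSubfamily a ℬ, add_comm (card _)]
    omega

theorem SimplyRooted.card_add_ite_le {ℬ : Finset (Finset ℕ)} (hsr : SimplyRooted ℬ)
    {B : Finset ℕ} (hB : B ∈ ℬ) :
    B.card + (if shadowSet B ⊆ ℬ then 1 else 0) ≤
      (B.filter fun i => B.erase i ∈ ℬ).card + 1 := by
  split_ifs with h
  · rw [filter_true_of_mem fun i hi => h (mem_image_of_mem _ hi)]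
  · rcases B.eq_empty_or_nonempty with rfl | hne
    · simp
    obtain ⟨b, hb, hroot⟩ := hsr B hB hne
    have hsub : B.erase b ⊆ B.filter fun i => B.erase i ∈ ℬ := fun i hi => by
      obtain ⟨hib, hi⟩ := mem_erase.1 hi
      exact mem_filter.2 ⟨hi, hroot _ (singleton_subset_iff.2 (mem_erase.2 ⟨hib.symm, hb⟩))
        (erase_subset _ _)⟩
    have := card_le_card hsub
    rw [card_erase_of_mem hb] at this
    omega

theorem SimplyRooted.totalSize_add_card_le {ℬ : Finset (Finset ℕ)} (hsr : SimplyRooted ℬ) :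
    totalSize ℬ + (ℬ.filter fun B => shadowSet B ⊆ ℬ).card ≤ edgeCount ℬ + ℬ.card := by
  rw [totalSize, edgeCount, card_filter, card_eq_sum_ones ℬ, ← sum_add_distrib,
    ← sum_add_distrib]
  exact sum_le_sum fun B hB => hsr.card_add_ite_le hB

/-- For a simply rooted family `ℬ ⊆ 𝒫(n)` of size `m`, where
`m'` is the number of `B ∈ ℬ` with `δB ⊆ ℬ`, we have `‖ℬ‖ ≤ ‖I(m)‖ + m - m'`. -/
theorem stmt12 (n : ℕ) (ℬ : Finset (Finset ℕ)) (hsub : ℬ ⊆ (Finset.Icc 1 n).powerset)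
    (hsr : SimplyRooted ℬ) (m m' : ℕ) (hm : m = ℬ.card)
    (hm' : m' = (ℬ.filter fun B => shadowSet B ⊆ ℬ).card) :
    (totalSize ℬ : ℤ) ≤ (totalSize (colexInit m) : ℤ) + (m : ℤ) - (m' : ℤ) := by
  have h₁ := hsr.totalSize_add_card_le
  have h₂ := edgeCount_le_totalSize_colexInit _ ℬ hsub
  subst hm hm'
  omega
end

section
/- Let ℬ, ℬ₁ and ℬ₂ be simply rooted families in 𝒫(n) with ℬ₁ ∪ ℬ₂ = ℬ, and let b be the number of bad sets of ℬ. Then |d(ℬ₁) ∩ d(ℬ₂)| ≤ b + |ℬ₁ ∩ ℬ₂|. -/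
open Finset
open scoped Classical

theorem compressSet_eq_self {𝒜 : Finset (Finset ℕ)} {i : ℕ} {B : Finset ℕ}
    (h : i ∈ B → B.erase i ∈ 𝒜) : compressSet 𝒜 i B = B :=
  if_neg fun h' => h'.2 (h h'.1)

theorem mem_dComp_of_erase_mem {𝒜 : Finset (Finset ℕ)} {i : ℕ} {B : Finset ℕ}
    (hB : B ∈ 𝒜) (h : i ∈ B → B.erase i ∈ 𝒜) : B ∈ dComp i 𝒜 :=
  mem_image.2 ⟨B, hB, compressSet_eq_self h⟩

theorem compressSet_injOn (𝒜 : Finset (Finset ℕ)) (i : ℕ) :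
    Set.InjOn (compressSet 𝒜 i) 𝒜 := by
  intro A hA B hB h
  rw [mem_coe] at hA hB
  unfold compressSet at h
  split_ifs at h with h1 h2 h2
  · rw [← insert_erase h1.1, h, insert_erase h2.1]
  · exact absurd (h ▸ hB) h1.2
  · exact absurd (h ▸ hA) h2.2
  · exact h

theorem DComp_eq_image (k : ℕ) (ℬ : Finset (Finset ℕ)) :
    DComp k ℬ = ℬ.image (DCompSet k ℬ) := by
  induction k with
  | zero => simp [DComp, DCompSet]
  | succ k ih =>
    ext C
    simp only [DComp, dComp, DCompSet, mem_image]
    constructor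
    · rintro ⟨D, hD, rfl⟩
      rw [ih, mem_image] at hD
      obtain ⟨B, hB, rfl⟩ := hD
      exact ⟨B, hB, rfl⟩
    · rintro ⟨B, hB, rfl⟩
      exact ⟨_, ih ▸ mem_image_of_mem _ hB, rfl⟩

theorem DCompSet_mem (k : ℕ) {ℬ : Finset (Finset ℕ)} {B : Finset ℕ} (hB : B ∈ ℬ) :
    DCompSet k ℬ B ∈ DComp k ℬ :=
  DComp_eq_image k ℬ ▸ mem_image_of_mem _ hB

theorem DCompSet_injOn (k : ℕ) (ℬ : Finset (Finset ℕ)) :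
    Set.InjOn (DCompSet k ℬ) ℬ := by
  induction k with
  | zero => exact fun _ _ _ _ h => h
  | succ k ih =>
    exact fun A hA B hB h =>
      ih hA hB (compressSet_injOn _ _ (DCompSet_mem k hA) (DCompSet_mem k hB) h)

theorem card_DComp (k : ℕ) (ℬ : Finset (Finset ℕ)) : (DComp k ℬ).card = ℬ.card := by
  rw [DComp_eq_image, card_image_of_injOn (DCompSet_injOn k ℬ)]

theorem RootedAt.mem {ℬ : Finset (Finset ℕ)} {B : Finset ℕ} {r : ℕ} (h : RootedAt ℬ B r) :
    B ∈ ℬ :=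
  h.2 B (singleton_subset_iff.2 h.1) Subset.rfl

theorem RootedAt.subset {ℬ : Finset (Finset ℕ)} {B C : Finset ℕ} {r : ℕ}
    (h : RootedAt ℬ B r) (hC : C ⊆ B) (hr : r ∈ C) : RootedAt ℬ C r :=
  ⟨hr, fun D hD hDC => h.2 D hD (hDC.trans hC)⟩

/-- A set rooted at `j` whose subset avoiding `j` is rooted at `r` is itself rooted at `r`. -/
theorem RootedAt.of_erase {ℬ : Finset (Finset ℕ)} {B : Finset ℕ} {j r : ℕ}
    (hj : RootedAt ℬ B j) (hr : RootedAt ℬ (B.erase j) r) : RootedAt ℬ B r := by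
  refine ⟨mem_of_mem_erase hr.1, fun C hrC hCB => ?_⟩
  by_cases hjC : j ∈ C
  · exact hj.2 C (singleton_subset_iff.2 hjC) hCB
  · exact hr.2 C hrC (subset_erase.2 ⟨hCB, hjC⟩)

/-- A set does not move before the compression in the direction of any of its roots. -/
theorem RootedAt.DCompSet_eq_self {ℬ : Finset (Finset ℕ)} {r k : ℕ} (hk : k < r)
    {B : Finset ℕ} (h : RootedAt ℬ B r) : DCompSet k ℬ B = B := by
  induction k generalizing B with
  | zero => rfl
  | succ k ih =>
    rw [DCompSet, ih (by omega) h]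
    refine compressSet_eq_self fun _ => ?_
    have h' := h.subset (erase_subset (k + 1) B) (mem_erase.2 ⟨by omega, h.1⟩)
    simpa only [ih (by omega) h'] using DCompSet_mem k h'.mem

theorem RootedAt.mem_DComp {ℬ : Finset (Finset ℕ)} {r k : ℕ} (hk : k < r)
    {B : Finset ℕ} (h : RootedAt ℬ B r) : B ∈ DComp k ℬ := by
  simpa only [h.DCompSet_eq_self hk] using DCompSet_mem k h.mem

/-- Once the compression in direction `r` is done, the cube below `B \ {r}` is present
for every set `B` rooted at `r`. -/
theorem RootedAt.mem_DComp_of_subset_erase {ℬ : Finset (Finset ℕ)} {r k : ℕ} (hr : 1 ≤ r)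
    (hk : r ≤ k) {B C : Finset ℕ} (h : RootedAt ℬ B r) (hC : C ⊆ B.erase r) :
    C ∈ DComp k ℬ := by
  induction k, hk using Nat.le_induction generalizing C with
  | base =>
    obtain ⟨k, rfl⟩ : ∃ k, r = k + 1 := ⟨r - 1, by omega⟩
    obtain ⟨hCB, hrC⟩ := subset_erase.1 hC
    by_cases hCD : C ∈ DComp k ℬ
    · exact mem_dComp_of_erase_mem hCD fun h' => absurd h' hrC
    · have hins := h.subset (insert_subset h.1 hCB) (mem_insert_self _ _)
      refine mem_image.2 ⟨_, hins.mem_DComp (Nat.lt_succ_self k), ?_⟩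
      have he : (insert (k + 1) C).erase (k + 1) = C := erase_insert hrC
      rw [compressSet, he, if_pos ⟨mem_insert_self _ _, hCD⟩]
  | succ k _ ih =>
    exact mem_dComp_of_erase_mem (ih hC) fun _ => ih ((erase_subset _ _).trans hC)

/-- Once all the roots of `B` have been processed, the cube below the image of `B` is present. -/
theorem mem_DComp_of_subset_DCompSet {ℬ : Finset (Finset ℕ)} (hsr : SimplyRooted ℬ)
    (h0 : ∀ B ∈ ℬ, 0 ∉ B) {k : ℕ} {B C : Finset ℕ} (hB : B ∈ ℬ)
    (hroots : ∀ r, RootedAt ℬ B r → r ≤ k) (hC : C ⊆ DCompSet k ℬ B) : C ∈ DComp k ℬ := by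
  induction k generalizing B C with
  | zero =>
    rcases B.eq_empty_or_nonempty with rfl | hne
    · obtain rfl : C = ∅ := subset_empty.1 hC
      exact hB
    · obtain ⟨r, hr⟩ := hsr B hB hne
      obtain rfl : r = 0 := Nat.le_zero.1 (hroots r hr)
      exact absurd hr.1 (h0 B hB)
  | succ k ih =>
    by_cases hj : RootedAt ℬ B (k + 1)
    · rw [DCompSet, hj.DCompSet_eq_self (Nat.lt_succ_self k), compressSet] at hC
      split_ifs at hC with hmove
      · exact hj.mem_DComp_of_subset_erase (by omega) le_rfl hC
      · have hmem : B.erase (k + 1) ∈ DComp k ℬ := by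
          by_contra h
          exact hmove ⟨hj.1, h⟩
        by_cases hjC : k + 1 ∈ C
        · refine mem_dComp_of_erase_mem
            ((hj.subset hC hjC).mem_DComp (Nat.lt_succ_self k)) fun _ => ?_
          rw [DComp_eq_image, mem_image] at hmem
          obtain ⟨A, hA, hAB⟩ := hmem
          by_cases hAr : ∃ r, RootedAt ℬ A r ∧ k < r
          · obtain ⟨r, hr, hkr⟩ := hAr
            rw [hr.DCompSet_eq_self hkr] at hAB
            subst hAB
            have hle := hroots r (hj.of_erase hr)
            have hne := ne_of_mem_erase hr.1
            omega
          · push Not at hAr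
            exact ih hA hAr (hAB ▸ erase_subset_erase _ hC)
        · exact hj.mem_DComp_of_subset_erase (by omega) le_rfl (subset_erase.2 ⟨hC, hjC⟩)
    · have hroots' : ∀ r, RootedAt ℬ B r → r ≤ k := fun r hr => by
        have hle := hroots r hr
        have hne : r ≠ k + 1 := fun h => hj (h ▸ hr)
        omega
      have hcube : ∀ D ⊆ DCompSet k ℬ B, D ∈ DComp k ℬ := fun D hD => ih hB hroots' hD
      rw [DCompSet, compressSet_eq_self fun _ => hcube _ (erase_subset _ _)] at hC
      exact mem_dComp_of_erase_mem (hcube _ hC) fun _ => hcube _ ((erase_subset _ _).trans hC)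

/-- A set with a unique root either stays put or loses exactly that root. -/
theorem DCompSet_eq_self_or_erase {ℬ : Finset (Finset ℕ)} (hsr : SimplyRooted ℬ)
    (h0 : ∀ B ∈ ℬ, 0 ∉ B) {i k : ℕ} {B : Finset ℕ} (hi : RootedAt ℬ B i)
    (huniq : ∀ r, RootedAt ℬ B r → r = i) :
    DCompSet k ℬ B = B ∨ DCompSet k ℬ B = B.erase i := by
  induction k with
  | zero => exact Or.inl rfl
  | succ k ih =>
    rcases lt_trichotomy (k + 1) i with hlt | rfl | hgt
    · exact Or.inl (hi.DCompSet_eq_self hlt)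
    · rw [DCompSet, hi.DCompSet_eq_self (Nat.lt_succ_self k), compressSet]
      split_ifs <;> simp
    · rwa [DCompSet, compressSet_eq_self fun _ => mem_DComp_of_subset_DCompSet hsr h0 hi.mem
        (fun r hr => by have := huniq r hr; omega) (erase_subset _ _)]

theorem exists_unique_root_of_not_badSet {n : ℕ} {ℬ : Finset (Finset ℕ)} {B : Finset ℕ}
    (hbad : ¬BadSet n ℬ B) : ∃ i ∈ B, ∀ r, RootedAt ℬ B r → r = i := by
  have hsh : ¬shadowSet B ⊆ ℬ := fun h => hbad (Or.inl h)
  obtain ⟨_, hA, hAℬ⟩ := not_subset.1 hsh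
  obtain ⟨i, hiB, rfl⟩ := mem_image.1 hA
  refine ⟨i, hiB, fun r hr => ?_⟩
  by_contra hne
  exact hAℬ (hr.subset (erase_subset i B) (mem_erase.2 ⟨hne, hr.1⟩)).mem

/-- The image of a set that is not bad belongs to the compression of every simply rooted
subfamily containing the set. -/
theorem DCompSet_mem_DComp_of_not_badSet {n : ℕ} {ℬ ℬ' : Finset (Finset ℕ)}
    (hsub : ℬ ⊆ (Finset.Icc 1 n).powerset) (hsr : SimplyRooted ℬ) (hsr' : SimplyRooted ℬ')
    (hle : ℬ' ⊆ ℬ) {B : Finset ℕ} (hB : B ∈ ℬ') (hbad : ¬BadSet n ℬ B) :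
    DCompSet n ℬ B ∈ DComp n ℬ' := by
  have hIcc : ∀ A ∈ ℬ, ∀ x ∈ A, 1 ≤ x ∧ x ≤ n := fun A hA x hx =>
    mem_Icc.1 (mem_powerset.1 (hsub hA) hx)
  have h0 : ∀ A ∈ ℬ, 0 ∉ A := fun A hA h => absurd (hIcc A hA 0 h).1 (by omega)
  obtain ⟨i, hiB, huniq⟩ := exists_unique_root_of_not_badSet hbad
  obtain ⟨r, hr : RootedAt ℬ' B r⟩ := hsr' B hB ⟨i, hiB⟩
  have hrℬ : RootedAt ℬ B r := ⟨hr.1, fun C h1 h2 => hle (hr.2 C h1 h2)⟩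
  obtain rfl := huniq r hrℬ
  rcases DCompSet_eq_self_or_erase (k := n) hsr h0 hrℬ huniq with h | h
  · exact absurd (Or.inr h) hbad
  · obtain ⟨h1, h2⟩ := hIcc B (hle hB) r hiB
    exact h ▸ hr.mem_DComp_of_subset_erase h1 h2 Subset.rfl

/-- Let `ℬ, ℬ₁, ℬ₂ ⊆ 𝒫(n)` be simply rooted with
`ℬ₁ ∪ ℬ₂ = ℬ`, and let `b` be the number of bad sets of `ℬ`. Then
`|d(ℬ₁) ∩ d(ℬ₂)| ≤ b + |ℬ₁ ∩ ℬ₂|`. -/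
theorem stmt16 (n : ℕ) (ℬ ℬ₁ ℬ₂ : Finset (Finset ℕ))
    (hsub : ℬ ⊆ (Finset.Icc 1 n).powerset)
    (hsr : SimplyRooted ℬ) (hsr1 : SimplyRooted ℬ₁) (hsr2 : SimplyRooted ℬ₂)
    (hunion : ℬ₁ ∪ ℬ₂ = ℬ)
    (b : ℕ) (hb : b = (ℬ.filter fun B => BadSet n ℬ B).card) :
    (DComp n ℬ₁ ∩ DComp n ℬ₂).card ≤ b + (ℬ₁ ∩ ℬ₂).card := by
  subst hunion hb
  have hgood : ((ℬ₁ ∪ ℬ₂).filter fun B => ¬BadSet n (ℬ₁ ∪ ℬ₂) B).card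
      ≤ (DComp n ℬ₁ ∪ DComp n ℬ₂).card := by
    refine card_le_card_of_injOn (DCompSet n (ℬ₁ ∪ ℬ₂)) (fun B hB => ?_)
      ((DCompSet_injOn n _).mono (filter_subset _ _))
    obtain ⟨hB, hbad⟩ := mem_filter.1 hB
    refine mem_union.2 ((mem_union.1 hB).imp (fun h => ?_) fun h => ?_)
    · exact DCompSet_mem_DComp_of_not_badSet hsub hsr hsr1 subset_union_left h hbad
    · exact DCompSet_mem_DComp_of_not_badSet hsub hsr hsr2 subset_union_right h hbad
  have hsplit : ((ℬ₁ ∪ ℬ₂).filter fun B => BadSet n (ℬ₁ ∪ ℬ₂) B).card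
      + ((ℬ₁ ∪ ℬ₂).filter fun B => ¬BadSet n (ℬ₁ ∪ ℬ₂) B).card = (ℬ₁ ∪ ℬ₂).card :=
    card_filter_add_card_filter_not _
  have hcard := card_union_add_card_inter ℬ₁ ℬ₂
  have hcardD := card_union_add_card_inter (DComp n ℬ₁) (DComp n ℬ₂)
  rw [card_DComp, card_DComp] at hcardD
  omega
end
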